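/- For odd n ≥ 1, ∑_{w ∈ B_n} η(w) t^{des_B(w)} = (1+t)(1-t)^{n-1}, and for even n ≥ 2, ∑_{w ∈ B_n} η(w) t^{des_B(w)} = (1-t)^n, where η(u^J) = sgn(u). -/

import Mathlib

open scoped Classical

/-- An element of the hyperoctahedral group `B_n`, encoded as an underlying
permutation `u ∈ S_n` together with the set of negated positions (`true` = negated). -/
abbrev BPerm (n : ℕ) := Equiv.Perm (Fin n) × (Fin n → Bool)

/-- The one-line value `w(i)` (as an integer, positions and values `1,…,n`)
of the signed permutation, with the convention `w(0) = 0`. -/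
noncomputable def bval {n : ℕ} (p : BPerm n) (i : ℕ) : ℤ :=
  if h : 1 ≤ i ∧ i ≤ n then
    (if p.2 ⟨i - 1, by omega⟩ then -(((p.1 ⟨i - 1, by omega⟩ : Fin n) : ℕ) + 1 : ℤ)
      else (((p.1 ⟨i - 1, by omega⟩ : Fin n) : ℕ) + 1 : ℤ))
  else 0

/-- The number of type B descents: `0 ≤ i ≤ n-1` with `w(i) > w(i+1)`, where `w(0)=0`. -/
noncomputable def desB {n : ℕ} (p : BPerm n) : ℕ :=
  ((Finset.range n).filter (fun i => bval p (i + 1) < bval p i)).card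

/-- The sign character of `B_n`: `sgn_B(u^J) = (-1)^{|J|} sgn(u)`. -/
noncomputable def sgnB {n : ℕ} (p : BPerm n) : ℤ :=
  (Equiv.Perm.sign p.1 : ℤ) * (-1) ^ ((Finset.univ.filter (fun i => p.2 i = true)).card)

/-- The one-dimensional character `η` of `B_n`: `η(u^J) = sgn(u)`. -/
noncomputable def etaB {n : ℕ} (p : BPerm n) : ℤ := (Equiv.Perm.sign p.1 : ℤ)

theorem bval_zero {n : ℕ} (p : BPerm n) : bval p 0 = 0 := by simp [bval]

theorem bval_succ {n : ℕ} (p : BPerm n) (i : Fin n) :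
    bval p (i + 1) = if p.2 i then -((p.1 i : ℕ) + 1 : ℤ) else ((p.1 i : ℕ) + 1 : ℤ) := by
  simp [bval, Nat.succ_le_of_lt i.isLt]

theorem desB_eq_sum {n : ℕ} (p : BPerm n) :
    desB p = ∑ i ∈ Finset.range n, if bval p (i + 1) < bval p i then 1 else 0 := by
  simp [desB]

/-- The absolute values `1` and `2` occupy adjacent positions and carry the same sign. -/
def SmallBlock {n : ℕ} (p : BPerm n) : Prop :=
  ∃ i j : Fin n, (i : ℕ) + 1 = j ∧ (p.1 i : ℕ) < 2 ∧ (p.1 j : ℕ) < 2 ∧ p.2 i = p.2 j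

/-- The absolute values `1` and `2` occupy the first two positions and carry the same sign. -/
def SmallPrefix {n : ℕ} (p : BPerm (n + 2)) : Prop :=
  (p.1 0 : ℕ) < 2 ∧ (p.1 1 : ℕ) < 2 ∧ p.2 0 = p.2 1

/-- Exchange the absolute values `1` and `2`, reversing both signs when they form a block. -/
noncomputable def swapSmall {n : ℕ} (p : BPerm (n + 2)) : BPerm (n + 2) :=
  (Equiv.swap 0 1 * p.1,
    fun i => if SmallBlock p ∧ (p.1 i : ℕ) < 2 then !p.2 i else p.2 i)

theorem swap_zero_one_val {n : ℕ} (a : Fin (n + 2)) :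
    ((Equiv.swap 0 1 a : Fin (n + 2)) : ℕ) = if (a : ℕ) < 2 then 1 - (a : ℕ) else a := by
  rcases eq_or_ne a 0 with rfl | h0
  · simp
  rcases eq_or_ne a 1 with rfl | h1
  · simp
  rw [Equiv.swap_apply_of_ne_of_ne h0 h1, if_neg]
  rw [Ne, Fin.ext_iff] at h0 h1
  simp only [Fin.val_zero, Fin.val_one] at h0 h1
  omega

theorem swap_zero_one_val_lt_two {n : ℕ} (a : Fin (n + 2)) :
    ((Equiv.swap 0 1 a : Fin (n + 2)) : ℕ) < 2 ↔ (a : ℕ) < 2 := by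
  rw [swap_zero_one_val]; split_ifs <;> omega

theorem eq_or_eq_of_val_lt_two {n : ℕ} {p : BPerm n} {i j k : Fin n} (hij : i ≠ j)
    (hi : (p.1 i : ℕ) < 2) (hj : (p.1 j : ℕ) < 2) (hk : (p.1 k : ℕ) < 2) : k = i ∨ k = j := by
  have key : ∀ a b : Fin n, (p.1 a : ℕ) = p.1 b → a = b := fun a b h =>
    p.1.injective (Fin.ext h)
  by_contra! h
  have h1 := mt (key k i) h.1
  have h2 := mt (key k j) h.2
  have h3 := mt (key i j) hij
  omega

theorem smallBlock_iff {n : ℕ} {p : BPerm n} {i j : Fin n} (hij : (i : ℕ) + 1 = j)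
    (hi : (p.1 i : ℕ) < 2) (hj : (p.1 j : ℕ) < 2) : SmallBlock p ↔ p.2 i = p.2 j := by
  refine ⟨?_, fun h => ⟨i, j, hij, hi, hj, h⟩⟩
  rintro ⟨k, l, hkl, hk, hl, h⟩
  have hne : i ≠ j := by rintro rfl; omega
  rcases eq_or_eq_of_val_lt_two hne hi hj hk with rfl | rfl <;>
    rcases eq_or_eq_of_val_lt_two hne hi hj hl with rfl | rfl <;> omega

theorem smallPrefix_of_smallBlock {n : ℕ} {p : BPerm (n + 2)} (h : SmallBlock p)
    (h0 : (p.1 0 : ℕ) < 2) : SmallPrefix p := by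
  obtain ⟨i, j, hij, hi, hj, h⟩ := h
  have hne : i ≠ j := by rintro rfl; omega
  have hz : ((0 : Fin (n + 2)) : ℕ) = 0 := rfl
  rcases eq_or_eq_of_val_lt_two hne hi hj h0 with rfl | rfl
  · have : j = 1 := Fin.ext (by simpa using hij.symm)
    subst this
    exact ⟨hi, hj, h⟩
  · omega

theorem swapSmall_fst_lt_two {n : ℕ} (p : BPerm (n + 2)) (i : Fin (n + 2)) :
    ((swapSmall p).1 i : ℕ) < 2 ↔ (p.1 i : ℕ) < 2 :=
  swap_zero_one_val_lt_two (p.1 i)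

theorem swapSmall_snd_eq_iff {n : ℕ} {p : BPerm (n + 2)} {i j : Fin (n + 2)}
    (hi : (p.1 i : ℕ) < 2) (hj : (p.1 j : ℕ) < 2) :
    (swapSmall p).2 i = (swapSmall p).2 j ↔ p.2 i = p.2 j := by
  by_cases h : SmallBlock p <;> simp only [swapSmall, h, hi, hj] <;> simp

theorem smallBlock_swapSmall {n : ℕ} (p : BPerm (n + 2)) :
    SmallBlock (swapSmall p) ↔ SmallBlock p := by
  simp only [SmallBlock, swapSmall_fst_lt_two]
  exact exists_congr fun i => exists_congr fun j => and_congr_right fun _ =>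
    and_congr_right fun hi => and_congr_right fun hj => swapSmall_snd_eq_iff hi hj

theorem smallPrefix_swapSmall {n : ℕ} (p : BPerm (n + 2)) :
    SmallPrefix (swapSmall p) ↔ SmallPrefix p := by
  simp only [SmallPrefix, swapSmall_fst_lt_two]
  exact and_congr_right fun hi => and_congr_right fun hj => swapSmall_snd_eq_iff hi hj

theorem swapSmall_swapSmall {n : ℕ} (p : BPerm (n + 2)) : swapSmall (swapSmall p) = p := by
  have h := smallBlock_swapSmall p
  refine Prod.ext ?_ ?_
  · simp [swapSmall, ← mul_assoc]
  · funext i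
    change (if SmallBlock (swapSmall p) ∧ _ then _ else _) = _
    simp only [h]
    simp only [swapSmall, Equiv.Perm.mul_apply, swap_zero_one_val_lt_two]
    split_ifs <;> simp

theorem etaB_swapSmall {n : ℕ} (p : BPerm (n + 2)) : etaB (swapSmall p) = -etaB p := by
  simp [etaB, swapSmall]

theorem desB_swapSmall {n : ℕ} {p : BPerm (n + 2)} (hp : ¬ SmallPrefix p) :
    desB (swapSmall p) = desB p := by
  have hval : ∀ i : Fin (n + 2), bval (swapSmall p) (i + 1) =
      if SmallBlock p ∧ (p.1 i : ℕ) < 2 then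
        (if p.2 i then (2 - (p.1 i : ℕ) : ℤ) else -(2 - (p.1 i : ℕ) : ℤ))
      else if (p.1 i : ℕ) < 2 then
        (if p.2 i then -(2 - (p.1 i : ℕ) : ℤ) else (2 - (p.1 i : ℕ) : ℤ))
      else (if p.2 i then -((p.1 i : ℕ) + 1 : ℤ) else ((p.1 i : ℕ) + 1 : ℤ)) := by
    intro i
    rw [bval_succ]
    simp only [swapSmall, Equiv.Perm.mul_apply, swap_zero_one_val]
    by_cases hB : SmallBlock p <;> by_cases hi : (p.1 i : ℕ) < 2 <;> cases p.2 i <;>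
      simp [hB, hi] <;> omega
  rw [desB_eq_sum, desB_eq_sum]
  refine Finset.sum_congr rfl fun i hi => if_congr ?_ rfl rfl
  rw [Finset.mem_range] at hi
  rcases i with _ | i
  · have h1 := hval 0
    have h2 := bval_succ p 0
    simp only [Fin.val_zero] at h1 h2
    rw [h1, h2, bval_zero, bval_zero, if_neg fun h => hp (smallPrefix_of_smallBlock h.1 h.2)]
    split_ifs <;> omega
  · have h1 := hval ⟨i, by omega⟩
    have h2 := bval_succ p ⟨i, by omega⟩
    have h3 := hval ⟨i + 1, hi⟩
    have h4 := bval_succ p ⟨i + 1, hi⟩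
    have h5 := smallBlock_iff (p := p) (i := ⟨i, by omega⟩) (j := ⟨i + 1, hi⟩) rfl
    have h6 : (p.1 ⟨i, by omega⟩ : ℕ) ≠ p.1 ⟨i + 1, hi⟩ := fun h => by
      simpa using p.1.injective (Fin.ext h)
    simp only at h1 h2 h3 h4
    rw [h1, h2, h3, h4]
    generalize (p.1 ⟨i, by omega⟩ : ℕ) = a at *
    generalize (p.1 ⟨i + 1, hi⟩ : ℕ) = b at *
    generalize p.2 ⟨i, by omega⟩ = s at *
    generalize p.2 ⟨i + 1, hi⟩ = t at *
    clear h1 h2 h3 h4 hval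
    by_cases hB : SmallBlock p <;> by_cases ha : a < 2 <;> by_cases hb : b < 2 <;>
      cases s <;> cases t <;> simp_all <;> omega

/-- The contribution of an element to the `η`-weighted descent polynomial. -/
noncomputable def etaTerm {n : ℕ} (p : BPerm n) : Polynomial ℤ :=
  etaB p • (Polynomial.X : Polynomial ℤ) ^ desB p

theorem sum_not_smallPrefix (n : ℕ) :
    ∑ p : BPerm (n + 2) with ¬ SmallPrefix p, etaTerm p = 0 := by
  refine Finset.sum_involution (fun p _ => swapSmall p) ?_ ?_ ?_ ?_
  · intro p hp
    rw [Finset.mem_filter_univ] at hp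
    simp [etaTerm, etaB_swapSmall, desB_swapSmall hp]
  · intro p _ _ h
    have := etaB_swapSmall p
    rw [h] at this
    have h0 : etaB p ≠ 0 := by simp [etaB]
    omega
  · intro p hp
    rw [Finset.mem_filter_univ] at hp ⊢
    rwa [smallPrefix_swapSmall]
  · intro p _
    exact swapSmall_swapSmall p

/-- Split off the first two values and the first two signs of a signed permutation. -/
def decomposeTwo (n : ℕ) :
    BPerm (n + 2) ≃ (Fin (n + 2) × Fin (n + 1) × Equiv.Perm (Fin n)) ×
      (Bool × Bool × (Fin n → Bool)) :=
  Equiv.prodCongr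
    (Equiv.Perm.decomposeFin.trans (Equiv.prodCongr (Equiv.refl _) Equiv.Perm.decomposeFin))
    ((Fin.consEquiv fun _ => Bool).symm.trans
      (Equiv.prodCongr (Equiv.refl _) (Fin.consEquiv fun _ => Bool).symm))

/-- Prepend a block with absolute values `1, 2` and common sign `s`;
the block is reversed when `r` is true. -/
def prependBlock {n : ℕ} (r s : Bool) (q : BPerm n) : BPerm (n + 2) :=
  (decomposeTwo n).symm ((if r then 1 else 0, 0, q.1), (s, s, q.2))

theorem prependBlock_fst_zero {n : ℕ} (r s : Bool) (q : BPerm n) :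
    ((prependBlock r s q).1 0 : ℕ) = r.toNat := by
  cases r <;> simp [prependBlock, decomposeTwo]

theorem prependBlock_fst_one {n : ℕ} (r s : Bool) (q : BPerm n) :
    ((prependBlock r s q).1 1 : ℕ) = 1 - r.toNat := by
  cases r <;> simp [prependBlock, decomposeTwo]

theorem prependBlock_fst_succ {n : ℕ} (r s : Bool) (q : BPerm n) (i : Fin n) :
    ((prependBlock r s q).1 i.succ.succ : ℕ) = q.1 i + 2 := by
  have h (k : Fin n) : Equiv.swap (0 : Fin (n + 2)) 1 k.succ.succ = k.succ.succ :=
    Equiv.swap_apply_of_ne_of_ne (Fin.succ_ne_zero _) (by simp [Fin.ext_iff])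
  cases r <;> simp [prependBlock, decomposeTwo, h]

theorem prependBlock_snd {n : ℕ} (r s : Bool) (q : BPerm n) :
    (prependBlock r s q).2 = Fin.cons s (Fin.cons s q.2) :=
  rfl

theorem etaB_prependBlock {n : ℕ} (r s : Bool) (q : BPerm n) :
    etaB (prependBlock r s q) = (-1) ^ r.toNat * etaB q := by
  cases r <;> simp [etaB, prependBlock, decomposeTwo]

theorem bval_prependBlock_add_three {n : ℕ} (r s : Bool) (q : BPerm n) (i : Fin n) :
    bval (prependBlock r s q) (i + 3) = bval q (i + 1) + if q.2 i then -2 else 2 := by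
  have h := bval_succ (prependBlock r s q) i.succ.succ
  rw [prependBlock_fst_succ, prependBlock_snd] at h
  simp only [Fin.val_succ, Fin.cons_succ] at h
  rw [h, bval_succ]
  split_ifs <;> push_cast <;> ring

theorem desB_prependBlock {n : ℕ} (r s : Bool) (q : BPerm n) :
    desB (prependBlock r s q) = desB q + if s then 2 - r.toNat else r.toNat := by
  have h1 := bval_succ (prependBlock r s q) 0
  have h2 := bval_succ (prependBlock r s q) 1
  rw [prependBlock_fst_zero, prependBlock_snd] at h1
  rw [prependBlock_fst_one, prependBlock_snd] at h2
  simp only [Fin.val_zero, Fin.val_one, Fin.cons_zero, Fin.cons_one, zero_add] at h1 h2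
  rw [desB_eq_sum, desB_eq_sum, Finset.sum_range_succ', Finset.sum_range_succ', add_assoc]
  congr 1
  · refine Finset.sum_congr rfl fun i hi => if_congr ?_ rfl rfl
    rw [Finset.mem_range] at hi
    have h3 := bval_prependBlock_add_three r s q ⟨i, hi⟩
    have h4 := bval_succ q ⟨i, hi⟩
    simp only at h3 h4
    rw [h3, h4]
    rcases i with _ | i
    · rw [bval_zero, zero_add, h2]
      cases r <;> cases s <;> split_ifs <;> simp <;> omega
    · have h5 := bval_prependBlock_add_three r s q ⟨i, by omega⟩
      have h6 := bval_succ q ⟨i, by omega⟩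
      simp only at h5 h6
      rw [show i + 1 + 1 + 1 = i + 3 by ring, h5, h6]
      split_ifs <;> omega
  · simp only [zero_add, h1, h2, bval_zero]
    cases r <;> cases s <;> simp

theorem etaTerm_prependBlock {n : ℕ} (r s : Bool) (q : BPerm n) :
    etaTerm (prependBlock r s q) =
      (-1) ^ r.toNat * Polynomial.X ^ (if s then 2 - r.toNat else r.toNat) * etaTerm q := by
  simp only [etaTerm, etaB_prependBlock, desB_prependBlock, zsmul_eq_mul, pow_add]
  push_cast
  ring

theorem smallPrefix_prependBlock {n : ℕ} (r s : Bool) (q : BPerm n) :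
    SmallPrefix (prependBlock r s q) := by
  refine ⟨?_, ?_, rfl⟩
  · rw [prependBlock_fst_zero]; cases r <;> simp
  · rw [prependBlock_fst_one]; omega

theorem exists_prependBlock_eq {n : ℕ} {p : BPerm (n + 2)} (hp : SmallPrefix p) :
    ∃ r s, ∃ q : BPerm n, prependBlock r s q = p := by
  obtain ⟨⟨⟨x, y, e⟩, s, t, v⟩, rfl⟩ := (decomposeTwo n).symm.surjective p
  obtain ⟨h0, h1, h2⟩ := hp
  obtain rfl : s = t := h2
  have hx : ((decomposeTwo n).symm ((x, y, e), s, s, v)).1 0 = x := by simp [decomposeTwo]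
  have hy : ((decomposeTwo n).symm ((x, y, e), s, s, v)).1 1 = Equiv.swap 0 x y.succ := by
    simp [decomposeTwo]
  rw [hx] at h0
  rw [hy] at h1
  have hx' : x = if decide (x = 1) then 1 else 0 := by
    split_ifs with h
    · simpa using h
    · rw [decide_eq_true_eq, Fin.ext_iff, Fin.val_one] at h
      exact Fin.ext (by rw [Fin.val_zero]; omega)
  have hy' : y = 0 := by
    by_contra hne
    have hne' : (y : ℕ) ≠ 0 := fun h => hne (Fin.ext h)
    rw [Equiv.swap_apply_of_ne_of_ne (Fin.succ_ne_zero y), Fin.val_succ] at h1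
    · omega
    · rintro rfl
      rw [Fin.val_succ] at h0
      omega
  refine ⟨decide (x = 1), s, (e, v), ?_⟩
  rw [prependBlock, ← hx', hy']

theorem prependBlock_injective {n : ℕ} :
    Function.Injective fun x : Bool × Bool × BPerm n => prependBlock x.1 x.2.1 x.2.2 := by
  rintro ⟨r, s, u, v⟩ ⟨r', s', u', v'⟩ h
  have := (decomposeTwo n).symm.injective h
  cases r <;> cases r' <;> simp_all

theorem sum_smallPrefix (n : ℕ) :
    ∑ p : BPerm (n + 2) with SmallPrefix p, etaTerm p =
      (1 - Polynomial.X) ^ 2 * ∑ q : BPerm n, etaTerm q := by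
  calc ∑ p : BPerm (n + 2) with SmallPrefix p, etaTerm p
      = ∑ x : Bool × Bool × BPerm n, etaTerm (prependBlock x.1 x.2.1 x.2.2) := by
        symm
        refine Finset.sum_nbij (fun x => prependBlock x.1 x.2.1 x.2.2) ?_
          prependBlock_injective.injOn ?_ fun _ _ => rfl
        · intro x _
          simpa using smallPrefix_prependBlock x.1 x.2.1 x.2.2
        · intro p hp
          obtain ⟨r, s, q, rfl⟩ := exists_prependBlock_eq (by simpa using hp)
          exact ⟨(r, s, q), by simp, rfl⟩
    _ = (1 - Polynomial.X) ^ 2 * ∑ q : BPerm n, etaTerm q := by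
        rw [Fintype.sum_prod_type, Fintype.sum_bool, Fintype.sum_prod_type, Fintype.sum_prod_type,
          Fintype.sum_bool, Fintype.sum_bool]
        simp only [etaTerm_prependBlock, ← Finset.mul_sum]
        simp
        ring

theorem sum_etaTerm_add_two (n : ℕ) :
    ∑ p : BPerm (n + 2), etaTerm p = (1 - Polynomial.X) ^ 2 * ∑ q : BPerm n, etaTerm q := by
  rw [← sum_smallPrefix, ← Finset.sum_filter_add_sum_filter_not _ SmallPrefix,
    sum_not_smallPrefix, add_zero]

theorem sum_etaTerm_zero : ∑ p : BPerm 0, etaTerm p = 1 := by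
  rw [Fintype.sum_prod_type, Fintype.sum_unique, Fintype.sum_unique]
  simp [etaTerm, etaB, desB]

theorem sum_etaTerm_one : ∑ p : BPerm 1, etaTerm p = 1 + Polynomial.X := by
  have h (v : Fin 1 → Bool) :
      etaTerm ((default, v) : BPerm 1) = if v 0 then Polynomial.X else 1 := by
    have h1 := bval_succ ((default, v) : BPerm 1) 0
    rw [etaTerm, desB_eq_sum, Finset.sum_range_one, bval_zero]
    simp only [Fin.val_zero, zero_add] at h1 ⊢
    rw [h1]
    cases v 0 <;> simp [etaB]
  rw [Fintype.sum_prod_type, Fintype.sum_unique, Fintype.sum_congr _ _ h,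
    ← (Equiv.funUnique (Fin 1) Bool).symm.sum_comp, Fintype.sum_bool]
  simp [add_comm]

theorem typeB_eta_eulerian (n : ℕ) :
    (Odd n →
      ∑ p : BPerm n, (etaB p) • (Polynomial.X : Polynomial ℤ) ^ (desB p)
        = (1 + Polynomial.X) * (1 - Polynomial.X) ^ (n - 1)) ∧
    (2 ≤ n → Even n →
      ∑ p : BPerm n, (etaB p) • (Polynomial.X : Polynomial ℤ) ^ (desB p)
        = (1 - Polynomial.X) ^ n) := by
  change (Odd n → ∑ p : BPerm n, etaTerm p = _) ∧ (2 ≤ n → Even n → ∑ p : BPerm n, etaTerm p = _)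
  have even_case (m : ℕ) : ∑ p : BPerm (2 * m), etaTerm p = (1 - Polynomial.X) ^ (2 * m) := by
    induction m with
    | zero => exact sum_etaTerm_zero
    | succ m ih => rw [mul_add, mul_one, sum_etaTerm_add_two, ih]; ring
  have odd_case (m : ℕ) : ∑ p : BPerm (2 * m + 1), etaTerm p =
      (1 + Polynomial.X) * (1 - Polynomial.X) ^ (2 * m) := by
    induction m with
    | zero => simpa using sum_etaTerm_one
    | succ m ih =>
      rw [show 2 * (m + 1) + 1 = 2 * m + 1 + 2 by ring, sum_etaTerm_add_two, ih]; ring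
  constructor
  · rintro ⟨m, rfl⟩
    exact odd_case m
  · rintro - hn
    obtain ⟨m, rfl⟩ := hn.two_dvd
    exact even_case m
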